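/- Let k ≥ 2 be an integer and let f : ℕ → ℝ be any function with f(l)/l → 0 as l → ∞. For each positive integer l, let H_k(l) be the number of (k,l)-intersection matrices and let A(l) be the number of (k,l)-intersection matrices N having at least one entry N_{i,j} with |N_{i,j} − l/k| ≤ f(l). Then A(l)/H_k(l) → 0 as l → ∞; equivalently, for a uniformly chosen (k,l)-intersection matrix X, asymptotically almost surely min_{i,j} |X_{i,j} − l/k| > f(l). -/

import Mathlib

/-- A `(k,l)`-intersection matrix: a `k × k` matrix of nonnegative integers all of whose
row sums and column sums equal `l`. -/
def IsInterMatrix (k l : ℕ) (N : Fin k → Fin k → ℕ) : Prop :=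
  (∀ i, ∑ j, N i j = l) ∧ ∀ j, ∑ i, N i j = l

/-- `|K_N|`: the order of the stabilizer of `N` under the action of `S_k × S_k`
simultaneously permuting rows and columns. -/
noncomputable def stabCard {k : ℕ} (N : Fin k → Fin k → ℕ) : ℕ :=
  Nat.card {p : Equiv.Perm (Fin k) × Equiv.Perm (Fin k) // ∀ i j, N (p.1 i) (p.2 j) = N i j}

/-- `|K_N| · ∏_{i,j} N_{i,j}!`, the order of the automorphism group of the `(k,l)`-bipartite
graph with bipartite adjacency matrix `N`. -/
noncomputable def autCard {k : ℕ} (N : Fin k → Fin k → ℕ) : ℕ :=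
  stabCard N * ∏ i, ∏ j, (N i j).factorial

theorem IsInterMatrix.apply_le {k l : ℕ} {N : Fin k → Fin k → ℕ} (h : IsInterMatrix k l N)
    (i j : Fin k) : N i j ≤ l :=
  (h.1 i) ▸ Finset.single_le_sum (f := N i) (fun _ _ => Nat.zero_le _) (Finset.mem_univ j)

theorem finite_interMatrix (k l : ℕ) :
    Finite {N : Fin k → Fin k → ℕ // IsInterMatrix k l N} := by
  refine Finite.of_injective (β := Fin k → Fin k → Fin (l + 1))
    (fun N i j => ⟨N.1 i j, Nat.lt_succ_of_le (N.2.apply_le i j)⟩) fun M N h => ?_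
  ext i j
  exact congrArg Fin.val (congrFun (congrFun h i) j)

/-- An intersection matrix is determined by the minor omitting one row and one column. -/
theorem IsInterMatrix.eq_of_minor_eq {m l : ℕ} {M N : Fin (m + 1) → Fin (m + 1) → ℕ}
    (hM : IsInterMatrix (m + 1) l M) (hN : IsInterMatrix (m + 1) l N) (r c : Fin (m + 1))
    (h : ∀ a b, M (r.succAbove a) (c.succAbove b) = N (r.succAbove a) (c.succAbove b)) :
    M = N := by
  have hrow : ∀ a j, M (r.succAbove a) j = N (r.succAbove a) j := by
    intro a j
    have h1 := hM.1 (r.succAbove a)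
    have h2 := hN.1 (r.succAbove a)
    rw [Fin.sum_univ_succAbove _ c] at h1 h2
    simp only [h] at h1
    refine Fin.succAboveCases (α := fun j => M (r.succAbove a) j = N (r.succAbove a) j)
      c ?_ (h a) j
    omega
  funext i j
  refine Fin.succAboveCases (α := fun i => M i j = N i j) r ?_ (fun a => hrow a j) i
  have h1 := hM.2 j
  have h2 := hN.2 j
  rw [Fin.sum_univ_succAbove _ r] at h1 h2
  simp only [hrow] at h1
  omega

/-- The number of intersection matrices with a prescribed entry in a finite set `T`. -/
theorem card_interMatrix_entry_mem_le {m : ℕ} (hm : 1 ≤ m) (l : ℕ) (i j : Fin (m + 1))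
    (T : Finset ℕ) :
    Nat.card {N : Fin (m + 1) → Fin (m + 1) → ℕ // IsInterMatrix (m + 1) l N ∧ N i j ∈ T} ≤
      T.card * (l + 1) ^ (m ^ 2 - 1) := by
  classical
  have : Nontrivial (Fin (m + 1)) := Fin.nontrivial_iff_two_le.2 (by omega)
  obtain ⟨r, hr⟩ := exists_ne i
  obtain ⟨c, hc⟩ := exists_ne j
  obtain ⟨a, rfl⟩ := Fin.exists_succAbove_eq hr.symm
  obtain ⟨b, rfl⟩ := Fin.exists_succAbove_eq hc.symm
  let S : Finset (Fin m × Fin m → ℕ) :=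
    Fintype.piFinset fun p => if p = (a, b) then T else Finset.range (l + 1)
  have hS : S.card = T.card * (l + 1) ^ (m ^ 2 - 1) := by
    rw [Fintype.card_piFinset, ← Finset.mul_prod_erase _ _ (Finset.mem_univ (a, b))]
    rw [Finset.prod_congr rfl (g := fun _ => l + 1)
      (fun p hp => by simp [Finset.ne_of_mem_erase hp])]
    simp [Finset.card_erase_of_mem, sq]
  rw [← hS, ← Nat.card_eq_finsetCard S]
  refine Nat.card_le_card_of_injective
    (fun N => ⟨fun p => N.1 (r.succAbove p.1) (c.succAbove p.2), ?_⟩) fun M N h => ?_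
  · rw [Fintype.mem_piFinset]
    intro p
    split_ifs with hp
    · subst hp
      exact N.2.2
    · exact Finset.mem_range.2 (Nat.lt_succ_of_le (N.2.1.apply_le _ _))
  · refine Subtype.ext (M.2.1.eq_of_minor_eq N.2.1 r c fun a b => ?_)
    exact congrFun (congrArg Subtype.val h) (a, b)

/-- The bordering of a square matrix by a zeroth row and column so that all line sums are `l`,
provided the line sums of the original matrix are at most `l` and its total is large enough. -/
def borderMatrix {m : ℕ} (l : ℕ) (A : Fin m → Fin m → ℕ) : Fin (m + 1) → Fin (m + 1) → ℕ :=
  Fin.cons (Fin.cons (∑ a, ∑ b, A a b + l - m * l) fun b => l - ∑ a, A a b)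
    fun a => Fin.cons (l - ∑ b, A a b) (A a)

theorem isInterMatrix_borderMatrix {m l : ℕ} {A : Fin m → Fin m → ℕ}
    (hrow : ∀ a, ∑ b, A a b ≤ l) (hcol : ∀ b, ∑ a, A a b ≤ l)
    (htot : m * l ≤ ∑ a, ∑ b, A a b + l) : IsInterMatrix (m + 1) l (borderMatrix l A) := by
  have hr : ∑ a, (l - ∑ b, A a b) + ∑ a, ∑ b, A a b = m * l := by
    rw [← Finset.sum_add_distrib, Finset.sum_congr rfl fun a _ => Nat.sub_add_cancel (hrow a)]
    simp
  have hc : ∑ b, (l - ∑ a, A a b) + ∑ a, ∑ b, A a b = m * l := by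
    rw [Finset.sum_comm (f := A), ← Finset.sum_add_distrib,
      Finset.sum_congr rfl fun b _ => Nat.sub_add_cancel (hcol b)]
    simp
  constructor
  · intro i
    rw [Fin.sum_univ_succ]
    cases i using Fin.cases with
    | zero =>
      simp only [borderMatrix, Fin.cons_zero, Fin.cons_succ]
      omega
    | succ a =>
      simp only [borderMatrix, Fin.cons_zero, Fin.cons_succ]
      exact Nat.sub_add_cancel (hrow a)
  · intro j
    rw [Fin.sum_univ_succ]
    cases j using Fin.cases with
    | zero =>
      simp only [borderMatrix, Fin.cons_zero, Fin.cons_succ]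
      omega
    | succ b =>
      simp only [borderMatrix, Fin.cons_zero, Fin.cons_succ]
      exact Nat.sub_add_cancel (hcol b)

/-- A lower bound of the correct order of magnitude for the number of intersection matrices. -/
theorem pow_le_card_interMatrix {m : ℕ} (hm : 1 ≤ m) (l : ℕ) :
    (l / m ^ 2) ^ m ^ 2 ≤
      Nat.card {N : Fin (m + 1) → Fin (m + 1) → ℕ // IsInterMatrix (m + 1) l N} := by
  have hlt : ∀ t : Fin (l / m ^ 2), m ^ 2 * (t + 1) ≤ l := fun t =>
    (Nat.mul_le_mul_left _ t.2).trans (Nat.mul_div_le _ _)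
  have hle : ∀ t : Fin (l / m ^ 2), (t : ℕ) ≤ l / m := fun t => by
    rw [Nat.le_div_iff_mul_le hm]
    nlinarith [hlt t]
  have hentry : ∀ t : Fin (l / m ^ 2), m * l ≤ m ^ 2 * (l / m - t) + l := fun t => by
    obtain ⟨q, hq⟩ := Nat.exists_eq_add_of_le (hle t)
    have h1 := hlt t
    have h2 := Nat.lt_mul_div_succ l hm
    rw [hq] at h2 ⊢
    rw [Nat.add_sub_cancel_left]
    nlinarith
  have := finite_interMatrix (m + 1) l
  have hcard : Nat.card (Fin m → Fin m → Fin (l / m ^ 2)) = (l / m ^ 2) ^ m ^ 2 := by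
    simp [sq, pow_mul]
  rw [← hcard]
  refine Nat.card_le_card_of_injective
    (fun t => ⟨borderMatrix l fun a b => l / m - t a b, isInterMatrix_borderMatrix ?_ ?_ ?_⟩)
    fun s t h => ?_
  · intro a
    refine (Finset.sum_le_card_nsmul _ _ (l / m) fun b _ => Nat.sub_le _ _).trans ?_
    simpa using Nat.mul_div_le l m
  · intro b
    refine (Finset.sum_le_card_nsmul _ _ (l / m) fun a _ => Nat.sub_le _ _).trans ?_
    simpa using Nat.mul_div_le l m
  · have hsum : ∑ _a : Fin m, ∑ _b : Fin m, m * l ≤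
        ∑ a, ∑ b, (m ^ 2 * (l / m - t a b) + l) :=
      Finset.sum_le_sum fun a _ => Finset.sum_le_sum fun b _ => hentry (t a b)
    simp only [Finset.sum_add_distrib, ← Finset.mul_sum, Finset.sum_const, Finset.card_univ,
      Fintype.card_fin, smul_eq_mul] at hsum
    refine le_of_mul_le_mul_left (a := m ^ 2) ?_ (by positivity)
    linarith
  · funext a b
    have hab := congrFun (congrFun (congrArg Subtype.val h) a.succ) b.succ
    simp only [borderMatrix, Fin.cons_succ] at hab
    have := hle (s a b)
    have := hle (t a b)
    exact Fin.ext (by omega)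

/-- An interval of radius `g` around a nonnegative real contains at most `2 * g + 1` naturals. -/
theorem card_Icc_ceil_floor_le {c g : ℝ} (hc : 0 ≤ c) (hg : 0 ≤ g) :
    ((Finset.Icc ⌈c - g⌉₊ ⌊c + g⌋₊).card : ℝ) ≤ 2 * g + 1 := by
  rw [Nat.card_Icc]
  rcases le_total ⌈c - g⌉₊ (⌊c + g⌋₊ + 1) with h | h
  · rw [Nat.cast_sub h]
    push_cast
    linarith [Nat.le_ceil (c - g), Nat.floor_le (add_nonneg hc hg)]
  · rw [Nat.sub_eq_zero_of_le h]
    push_cast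
    linarith

theorem card_interMatrix_near_mean_le {m : ℕ} (hm : 1 ≤ m) (l : ℕ) (x : ℝ) :
    (Nat.card {N : Fin (m + 1) → Fin (m + 1) → ℕ // IsInterMatrix (m + 1) l N ∧
        ∃ i j, |(N i j : ℝ) - (l : ℝ) / ((m + 1 : ℕ) : ℝ)| ≤ x} : ℝ) ≤
      (m + 1) ^ 2 * ((2 * |x| + 1) * (l + 1) ^ (m ^ 2 - 1)) := by
  set c : ℝ := (l : ℝ) / ((m + 1 : ℕ) : ℝ)
  have hc0 : 0 ≤ c := by positivity
  set T : Finset ℕ := Finset.Icc ⌈c - |x|⌉₊ ⌊c + |x|⌋₊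
  let E : Fin (m + 1) × Fin (m + 1) → Set (Fin (m + 1) → Fin (m + 1) → ℕ) :=
    fun p => {N | IsInterMatrix (m + 1) l N ∧ N p.1 p.2 ∈ T}
  have hE : ∀ p, (E p).ncard ≤ T.card * (l + 1) ^ (m ^ 2 - 1) := fun p =>
    card_interMatrix_entry_mem_le hm l p.1 p.2 T
  have hfin : (⋃ p, E p).Finite :=
    (Set.finite_coe_iff.1 (finite_interMatrix (m + 1) l)).subset
      (Set.iUnion_subset fun p N hN => hN.1)
  have hsub : {N : Fin (m + 1) → Fin (m + 1) → ℕ | IsInterMatrix (m + 1) l N ∧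
      ∃ i j, |(N i j : ℝ) - c| ≤ x} ⊆ ⋃ p, E p := by
    rintro N ⟨hN, i, j, hij⟩
    have hx := abs_le.1 (hij.trans (le_abs_self x))
    refine Set.mem_iUnion.2 ⟨(i, j), hN, Finset.mem_Icc.2 ⟨?_, ?_⟩⟩
    · exact Nat.ceil_le.2 (by linarith)
    · exact Nat.le_floor (by linarith)
  have hcard := ((Set.ncard_le_ncard hsub hfin).trans (Set.ncard_iUnion_le_of_fintype E)).trans
    (Finset.sum_le_card_nsmul _ _ _ fun p _ => hE p)
  have hcard' := (Nat.cast_le (α := ℝ)).2 hcard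
  refine hcard'.trans ?_
  simp only [Finset.card_univ, Fintype.card_prod, Fintype.card_fin, smul_eq_mul]
  push_cast
  rw [← sq]
  gcongr
  exact card_Icc_ceil_floor_le hc0 (abs_nonneg x)

/-- For a uniformly chosen `(k,l)`-intersection matrix, asymptotically almost surely every
entry differs from `l/k` by more than `f(l)`, for any `f` with `f(l)/l → 0`: the proportion
of matrices having some entry within `f(l)` of `l/k` tends to `0` as `l → ∞`. -/
theorem entries_far_from_mean (k : ℕ) (hk : 2 ≤ k) (f : ℕ → ℝ)
    (hf : Filter.Tendsto (fun l : ℕ => f l / (l : ℝ)) Filter.atTop (nhds 0)) :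
    Filter.Tendsto (fun l : ℕ =>
      (Nat.card {N : Fin k → Fin k → ℕ // IsInterMatrix k l N ∧
          ∃ i j, |(N i j : ℝ) - (l : ℝ) / (k : ℝ)| ≤ f l} : ℝ) /
        (Nat.card {N : Fin k → Fin k → ℕ // IsInterMatrix k l N} : ℝ))
      Filter.atTop (nhds 0) := by
  obtain ⟨m, rfl⟩ : ∃ m, k = m + 1 := ⟨k - 1, by omega⟩
  have hm : 1 ≤ m := by omega
  set C : ℝ := (m + 1) ^ 2 * 2 ^ (m ^ 2 - 1) * (2 * m ^ 2) ^ m ^ 2 with hC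
  have hlim : Filter.Tendsto (fun l : ℕ => C * (2 * |f l / l| + 1 / (l : ℝ)))
      Filter.atTop (nhds 0) := by
    simpa using ((hf.abs.const_mul 2).add tendsto_one_div_atTop_nhds_zero_nat).const_mul C
  refine squeeze_zero' (Filter.Eventually.of_forall fun l => by positivity) ?_ hlim
  filter_upwards [Filter.eventually_ge_atTop (m ^ 2)] with l hl
  have hm2 : 0 < m ^ 2 := by positivity
  have hl0 : 1 ≤ l := hm2.trans_le hl
  have hlR : (1 : ℝ) ≤ l := by exact_mod_cast hl0
  have hlpos : (0 : ℝ) < l := by linarith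
  have hmR : (0 : ℝ) < m := by exact_mod_cast hm
  have hfloor : (l : ℝ) / (2 * m ^ 2) ≤ ((l / m ^ 2 : ℕ) : ℝ) := by
    rw [div_le_iff₀ (by positivity)]
    have h1 := Nat.lt_mul_div_succ l hm2
    have h2 : 1 ≤ l / m ^ 2 := (Nat.one_le_div_iff hm2).2 hl
    have h3 : l ≤ l / m ^ 2 * (2 * m ^ 2) := by nlinarith
    exact_mod_cast h3
  have hden : ((l : ℝ) / (2 * m ^ 2)) ^ m ^ 2 ≤
      (Nat.card {N : Fin (m + 1) → Fin (m + 1) → ℕ // IsInterMatrix (m + 1) l N} : ℝ) :=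
    (pow_le_pow_left₀ (by positivity) hfloor _).trans
      (by exact_mod_cast pow_le_card_interMatrix hm l)
  have hnum := card_interMatrix_near_mean_le hm l (f l)
  have hnum' : ((m : ℝ) + 1) ^ 2 * ((2 * |f l| + 1) * (l + 1) ^ (m ^ 2 - 1)) ≤
      (m + 1) ^ 2 * ((2 * |f l| + 1) * (2 * l) ^ (m ^ 2 - 1)) := by
    gcongr
    linarith
  refine (div_le_div₀ (by positivity) (hnum.trans hnum') (by positivity) hden).trans_eq ?_
  obtain ⟨n, hn⟩ : ∃ n, m ^ 2 = n + 1 := ⟨m ^ 2 - 1, by omega⟩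
  rw [hC, abs_div, abs_of_pos hlpos, hn, Nat.add_sub_cancel, div_pow, mul_pow 2 (l : ℝ)]
  field_simp
  exact (pow_succ _ _).symm
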